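/- Let a be the boundary Lie algebra (basis h, h', e, f; nonzero brackets [h,e]=4p·e, [h,f]=-4p·f, [e,f]=(p/2)·h', p ≠ 0). The symmetric bilinear form B on a determined by B(h,h') = B(h',h) = 8, B(e,f) = B(f,e) = 1, and B = 0 on all other pairs of basis vectors, is nondegenerate and invariant: B([x,y],z) = B(x,[y,z]) for all x, y, z ∈ a. -/

import Mathlib

noncomputable section
open scoped TensorProduct

noncomputable section

/-- The carrier of the boundary Lie algebra `a` (depends on the parameter `p`);
coordinates are taken with respect to the basis `h, h', e, f`. -/
def BoundaryA (_p : ℂ) : Type := ℂ × ℂ × ℂ × ℂ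

namespace BoundaryA

variable {p : ℂ}

instance : AddCommGroup (BoundaryA p) := inferInstanceAs (AddCommGroup (ℂ × ℂ × ℂ × ℂ))
instance : Module ℂ (BoundaryA p) := inferInstanceAs (Module ℂ (ℂ × ℂ × ℂ × ℂ))
instance : Module.Finite ℂ (BoundaryA p) := inferInstanceAs (Module.Finite ℂ (ℂ × ℂ × ℂ × ℂ))

/-- Build an element of `a` from its coordinates in the basis `h, h', e, f`. -/
def mk' (a b c d : ℂ) : BoundaryA p := (a, b, c, d)

/-- coefficient of `h` -/
def cH (x : BoundaryA p) : ℂ := x.1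
/-- coefficient of `h'` -/
def cH' (x : BoundaryA p) : ℂ := x.2.1
/-- coefficient of `e` -/
def cE (x : BoundaryA p) : ℂ := x.2.2.1
/-- coefficient of `f` -/
def cF (x : BoundaryA p) : ℂ := x.2.2.2

/-- The basis vector `h`. -/
def h : BoundaryA p := mk' 1 0 0 0
/-- The basis vector `h'`. -/
def h' : BoundaryA p := mk' 0 1 0 0
/-- The basis vector `e`. -/
def e : BoundaryA p := mk' 0 0 1 0
/-- The basis vector `f`. -/
def f : BoundaryA p := mk' 0 0 0 1

/-- The bracket of the boundary Lie algebra `a`: the bilinear antisymmetric extension of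
`[h,e] = 4p·e`, `[h,f] = -4p·f`, `[e,f] = (p/2)·h'`, `[h,h'] = [h',e] = [h',f] = 0`. -/
def br (x y : BoundaryA p) : BoundaryA p :=
  mk' 0
      (p / 2 * (cE x * cF y - cF x * cE y))
      (4 * p * (cH x * cE y - cE x * cH y))
      (-(4 * p) * (cH x * cF y - cF x * cH y))

lemma ext4 {x y : BoundaryA p} (h1 : cH x = cH y) (h2 : cH' x = cH' y)
    (h3 : cE x = cE y) (h4 : cF x = cF y) : x = y := by
  exact Prod.ext h1 (Prod.ext h2 (Prod.ext h3 h4))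

@[simp] lemma cH_mk (a b c d : ℂ) : cH (mk' a b c d : BoundaryA p) = a := rfl
@[simp] lemma cH'_mk (a b c d : ℂ) : cH' (mk' a b c d : BoundaryA p) = b := rfl
@[simp] lemma cE_mk (a b c d : ℂ) : cE (mk' a b c d : BoundaryA p) = c := rfl
@[simp] lemma cF_mk (a b c d : ℂ) : cF (mk' a b c d : BoundaryA p) = d := rfl

@[simp] lemma cH_add (x y : BoundaryA p) : cH (x + y) = cH x + cH y := rfl
@[simp] lemma cH'_add (x y : BoundaryA p) : cH' (x + y) = cH' x + cH' y := rfl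
@[simp] lemma cE_add (x y : BoundaryA p) : cE (x + y) = cE x + cE y := rfl
@[simp] lemma cF_add (x y : BoundaryA p) : cF (x + y) = cF x + cF y := rfl

@[simp] lemma cH_smul (t : ℂ) (x : BoundaryA p) : cH (t • x) = t * cH x := rfl
@[simp] lemma cH'_smul (t : ℂ) (x : BoundaryA p) : cH' (t • x) = t * cH' x := rfl
@[simp] lemma cE_smul (t : ℂ) (x : BoundaryA p) : cE (t • x) = t * cE x := rfl
@[simp] lemma cF_smul (t : ℂ) (x : BoundaryA p) : cF (t • x) = t * cF x := rfl

@[simp] lemma cH_neg (x : BoundaryA p) : cH (-x) = -cH x := rfl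
@[simp] lemma cH'_neg (x : BoundaryA p) : cH' (-x) = -cH' x := rfl
@[simp] lemma cE_neg (x : BoundaryA p) : cE (-x) = -cE x := rfl
@[simp] lemma cF_neg (x : BoundaryA p) : cF (-x) = -cF x := rfl

@[simp] lemma cH_zero : cH (0 : BoundaryA p) = 0 := rfl
@[simp] lemma cH'_zero : cH' (0 : BoundaryA p) = 0 := rfl
@[simp] lemma cE_zero : cE (0 : BoundaryA p) = 0 := rfl
@[simp] lemma cF_zero : cF (0 : BoundaryA p) = 0 := rfl

instance : LieRing (BoundaryA p) where
  bracket := br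
  add_lie x y z := by refine ext4 ?_ ?_ ?_ ?_ <;> simp only [br, cH_mk, cH'_mk, cE_mk, cF_mk, cH_add, cH'_add, cE_add, cF_add, cH_zero, cH'_zero, cE_zero, cF_zero] <;> ring
  lie_add x y z := by refine ext4 ?_ ?_ ?_ ?_ <;> simp only [br, cH_mk, cH'_mk, cE_mk, cF_mk, cH_add, cH'_add, cE_add, cF_add, cH_zero, cH'_zero, cE_zero, cF_zero] <;> ring
  lie_self x := by refine ext4 ?_ ?_ ?_ ?_ <;> simp only [br, cH_mk, cH'_mk, cE_mk, cF_mk, cH_add, cH'_add, cE_add, cF_add, cH_zero, cH'_zero, cE_zero, cF_zero] <;> ring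
  leibniz_lie x y z := by refine ext4 ?_ ?_ ?_ ?_ <;> simp only [br, cH_mk, cH'_mk, cE_mk, cF_mk, cH_add, cH'_add, cE_add, cF_add, cH_zero, cH'_zero, cE_zero, cF_zero] <;> ring

instance : LieAlgebra ℂ (BoundaryA p) where
  lie_smul t x y := by refine ext4 ?_ ?_ ?_ ?_ <;> simp only [Bracket.bracket, br, cH_mk, cH'_mk, cE_mk, cF_mk, cH_smul, cH'_smul, cE_smul, cF_smul] <;> ring

@[simp] lemma lie_def (x y : BoundaryA p) : ⁅x, y⁆ = br x y := rfl

lemma lie_h_e : ⁅(h : BoundaryA p), (e : BoundaryA p)⁆ = (4 * p) • e := by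
  refine ext4 ?_ ?_ ?_ ?_ <;> simp [br, h, e]

lemma lie_h_f : ⁅(h : BoundaryA p), (f : BoundaryA p)⁆ = (-(4 * p)) • f := by
  refine ext4 ?_ ?_ ?_ ?_ <;> simp [br, h, f]

lemma lie_e_f : ⁅(e : BoundaryA p), (f : BoundaryA p)⁆ = (p / 2) • h' := by
  refine ext4 ?_ ?_ ?_ ?_ <;> simp [br, h', e, f]

lemma lie_h_h' : ⁅(h : BoundaryA p), (h' : BoundaryA p)⁆ = 0 := by
  refine ext4 ?_ ?_ ?_ ?_ <;> simp [br, h, h']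

end BoundaryA

/-- The invariant symmetric bilinear form `B` on the boundary Lie algebra `a`:
`B(h,h') = B(h',h) = 8`, `B(e,f) = B(f,e) = 1`, and `B = 0` on all other pairs
of basis vectors. -/
def Bform (p : ℂ) : LinearMap.BilinForm ℂ (BoundaryA p) :=
  LinearMap.mk₂ ℂ
    (fun x y => 8 * (BoundaryA.cH x * BoundaryA.cH' y + BoundaryA.cH' x * BoundaryA.cH y)
      + (BoundaryA.cE x * BoundaryA.cF y + BoundaryA.cF x * BoundaryA.cE y))
    (by intros; simp; ring) (by intros; simp; ring)
    (by intros; simp; ring) (by intros; simp; ring)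

/-- the symmetric bilinear form `B` on the boundary Lie algebra `a` with
`B(h,h') = 8`, `B(e,f) = 1` and `B = 0` on all other pairs of basis vectors is
nondegenerate and invariant. -/
theorem statement4 (p : ℂ) (hp : p ≠ 0) :
    -- B is symmetric
    (∀ x y : BoundaryA p, Bform p x y = Bform p y x) ∧
    -- the prescribed values on pairs of basis vectors
    Bform p BoundaryA.h BoundaryA.h' = 8 ∧
    Bform p BoundaryA.e BoundaryA.f = 1 ∧
    Bform p BoundaryA.h BoundaryA.h = 0 ∧
    Bform p BoundaryA.h BoundaryA.e = 0 ∧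
    Bform p BoundaryA.h BoundaryA.f = 0 ∧
    Bform p BoundaryA.h' BoundaryA.h' = 0 ∧
    Bform p BoundaryA.h' BoundaryA.e = 0 ∧
    Bform p BoundaryA.h' BoundaryA.f = 0 ∧
    Bform p BoundaryA.e BoundaryA.e = 0 ∧
    Bform p BoundaryA.f BoundaryA.f = 0 ∧
    -- B is nondegenerate
    (Bform p).Nondegenerate ∧
    -- B is invariant
    (∀ x y z : BoundaryA p, Bform p ⁅x, y⁆ z = Bform p x ⁅y, z⁆) := by
  have key : ∀ x y : BoundaryA p, Bform p x y =
      8 * (BoundaryA.cH x * BoundaryA.cH' y + BoundaryA.cH' x * BoundaryA.cH y)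
      + (BoundaryA.cE x * BoundaryA.cF y + BoundaryA.cF x * BoundaryA.cE y) := fun _ _ => rfl
  have symm : ∀ x y : BoundaryA p, Bform p x y = Bform p y x := by
    intro x y
    rw [key, key]
    ring
  have sep : ∀ x : BoundaryA p, (∀ y, Bform p x y = 0) → x = 0 := by
    intro x hx
    have h1 := hx BoundaryA.h
    have h2 := hx BoundaryA.h'
    have h3 := hx BoundaryA.e
    have h4 := hx BoundaryA.f
    rw [key] at h1 h2 h3 h4
    simp [BoundaryA.h, BoundaryA.h', BoundaryA.e, BoundaryA.f] at h1 h2 h3 h4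
    exact BoundaryA.ext4 h2 h1 h4 h3
  refine ⟨symm, ?_, ?_, ?_, ?_, ?_, ?_, ?_, ?_, ?_, ?_, ⟨sep, ?_⟩, ?_⟩
  iterate 10
    · rw [key]
      simp [BoundaryA.h, BoundaryA.h', BoundaryA.e, BoundaryA.f]
  · intro y hy
    exact sep y fun x => by rw [symm]; exact hy x
  · intro x y z
    rw [key, key]
    simp only [BoundaryA.lie_def, BoundaryA.br, BoundaryA.cH_mk, BoundaryA.cH'_mk,
      BoundaryA.cE_mk, BoundaryA.cF_mk]
    ring
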